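/- (Facet count of the almost cyclic polytope for even d.) Let d ≥ 2 be even, s ≥ 0, n > d+s, let C(d,n,s) be the almost cyclic polytope with its non-simplex facet F, and let C' be the complex of all proper faces of C(d,n,s) except F. Then the number of facets of C' (equivalently, the number of simplex facets of C(d,n,s)) equals C(n−d/2−1, d/2) + 2·Σ_{i=0}^{d/2−1} C(n−d−1+i, i) − C(s+d/2, d/2), where C(a,b) denotes the binomial coefficient. -/

import Mathlib

open Finset

namespace ASP

noncomputable section

/-- The dot product of two vectors in `ℝ^d`. -/
def dotp {d : ℕ} (x y : Fin d → ℝ) : ℝ := ∑ i, x i * y i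

/-- `F` is a face of the polytope `P ⊆ ℝ^d`: the intersection of `P` with a supporting
hyperplane, together with the empty face and `P` itself. -/
def IsFaceOf {d : ℕ} (P F : Set (Fin d → ℝ)) : Prop :=
  F = ∅ ∨ F = P ∨
    ∃ (b : Fin d → ℝ) (c : ℝ), b ≠ 0 ∧ (∀ x ∈ P, dotp b x ≤ c) ∧
      F = {x ∈ P | dotp b x = c}

/-- The dimension of a subset of `ℝ^d`: the dimension of its affine span. -/
def polyDim {d : ℕ} (S : Set (Fin d → ℝ)) : ℕ :=
  Module.finrank ℝ (affineSpan ℝ S).direction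

/-- A polytope: the convex hull of a finite point set. -/
def IsPolytope {d : ℕ} (P : Set (Fin d → ℝ)) : Prop :=
  ∃ V : Finset (Fin d → ℝ), P = convexHull ℝ (V : Set (Fin d → ℝ))

/-- The vertex set of a polytope: its set of extreme points. -/
def verts {d : ℕ} (P : Set (Fin d → ℝ)) : Set (Fin d → ℝ) :=
  Set.extremePoints ℝ P

/-- `fVec P i` is the number of `i`-dimensional (nonempty) faces of `P`. -/
def fVec {d : ℕ} (P : Set (Fin d → ℝ)) (i : ℕ) : ℕ :=
  {F : Set (Fin d → ℝ) | IsFaceOf P F ∧ F.Nonempty ∧ polyDim F = i}.ncard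

/-- A facet of a `d`-polytope in `ℝ^d`: a `(d-1)`-dimensional face. -/
def IsFacetOf {d : ℕ} (P F : Set (Fin d → ℝ)) : Prop :=
  IsFaceOf P F ∧ F.Nonempty ∧ polyDim F = d - 1

/-- `(P, F)` is an ASP-pair: `P` is a `d`-polytope, `F` is a facet of `P`, and every facet
of `P` other than `F` is a simplex (i.e. has exactly `d` vertices). -/
def IsASPPair {d : ℕ} (P F : Set (Fin d → ℝ)) : Prop :=
  IsPolytope P ∧ polyDim P = d ∧ IsFacetOf P F ∧
    ∀ G, IsFacetOf P G → G ≠ F → (verts G).ncard = d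

/-- `P ∈ 𝒫(d,n,s)`: `P` is a `d`-polytope with `n` vertices such that `(P,F)` is an
ASP-pair where the facet `F` has `d + s` vertices. -/
def MemASP (d n s : ℕ) (P : Set (Fin d → ℝ)) : Prop :=
  (verts P).ncard = n ∧ ∃ F, IsASPPair P F ∧ (verts F).ncard = d + s

/-- `fBall P i` is `f_{i-1}(P')` of the simplicial ball `P' = ∂P - {F}` consisting of all
proper faces of `P` except its (unique non-simplex) facet `F`; the index is shifted by one,
so `fBall P 0 = f_{-1} = 1` counts the empty face, and at the top dimension the facet `F`
is discarded. -/
def fBall {d : ℕ} (P : Set (Fin d → ℝ)) (i : ℕ) : ℤ :=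
  if i = 0 then 1
  else if i = d then (fVec P (d - 1) : ℤ) - 1
  else if d < i then 0
  else (fVec P (i - 1) : ℤ)

/-- `hBall P k` is `h_k(P')` of the `(d-1)`-dimensional ball `P' = ∂P - {F}`, defined by
`h_k = ∑_{i=0}^{k} (-1)^{k-i} C(d-i, k-i) f_{i-1}(P')`, extended by `0` outside `0 ≤ k ≤ d`. -/
def hBall {d : ℕ} (P : Set (Fin d → ℝ)) (k : ℤ) : ℤ :=
  if 0 ≤ k ∧ k ≤ (d : ℤ) then
    ∑ i ∈ Finset.range (k.toNat + 1),
      (-1) ^ (k.toNat - i) * ((d - i).choose (k.toNat - i) : ℤ) * fBall P i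
  else 0

/-- `fBd m Q i` is `f_{i-1}(∂Q)` of the boundary complex of an `m`-polytope `Q ⊆ ℝ^d`
(a complex of dimension `m - 1`); the index is shifted by one. -/
def fBd {d : ℕ} (m : ℕ) (Q : Set (Fin d → ℝ)) (i : ℕ) : ℤ :=
  if i = 0 then 1 else if m + 1 ≤ i then 0 else (fVec Q (i - 1) : ℤ)

/-- `hBd m Q k` is `h_k(∂Q)` for the boundary complex of an `m`-polytope `Q ⊆ ℝ^d`, defined by
`h_k = ∑_{i=0}^{k} (-1)^{k-i} C(m-i, k-i) f_{i-1}(∂Q)`, extended by `0` outside `0 ≤ k ≤ m`. -/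
def hBd {d : ℕ} (m : ℕ) (Q : Set (Fin d → ℝ)) (k : ℤ) : ℤ :=
  if 0 ≤ k ∧ k ≤ (m : ℤ) then
    ∑ i ∈ Finset.range (k.toNat + 1),
      (-1) ^ (k.toNat - i) * ((m - i).choose (k.toNat - i) : ℤ) * fBd m Q i
  else 0

/-- `gBd m Q k = g_k(∂Q) = h_k(∂Q) - h_{k-1}(∂Q)`. -/
def gBd {d : ℕ} (m : ℕ) (Q : Set (Fin d → ℝ)) (k : ℤ) : ℤ :=
  hBd m Q k - hBd m Q (k - 1)

/-- The function `p(t) = (n-1)^{(t-1)(d-1)} · t(t+1)⋯(t+d+s-1)` (real exponentiation of the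
positive base `n-1`) used to define the almost cyclic polytope. -/
def acp (d n s : ℕ) (t : ℝ) : ℝ :=
  ((n : ℝ) - 1) ^ ((t - 1) * ((d : ℝ) - 1)) * ∏ l ∈ Finset.range (d + s), (t + l)

/-- The curve `y(t) = (t, t², …, t^{d-1}, p(t)) ∈ ℝ^d`. -/
def acy (d n s : ℕ) (t : ℝ) : Fin d → ℝ :=
  fun i => if (i : ℕ) + 1 = d then acp d n s t else t ^ ((i : ℕ) + 1)

/-- The parameter values `t_i = -s - d + i` for `i = 1, …, n` (here `0`-indexed:
`acT d s j = t_{j+1}`). -/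
def acT (d s j : ℕ) : ℝ := (j : ℝ) + 1 - s - d

/-- The `n` points `y(t_1), …, y(t_n)` on the curve `y` (`0`-indexed). -/
def acPoint (d n s : ℕ) (j : Fin n) : Fin d → ℝ := acy d n s (acT d s (j : ℕ))

/-- The almost cyclic polytope `C(d,n,s) = conv{y(t_1), …, y(t_n)}`. -/
def acPolytope (d n s : ℕ) : Set (Fin d → ℝ) :=
  convexHull ℝ (Set.range (acPoint d n s))

/-- The non-simplex facet `F = conv{y(t_1), …, y(t_{d+s})}` of the almost cyclic polytope. -/
def acFacet (d n s : ℕ) : Set (Fin d → ℝ) :=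
  convexHull ℝ (acPoint d n s '' {j : Fin n | (j : ℕ) < d + s})

/-- The generalized moment curve
`x(t) = (t, t², …, t^{d-r}, p_1(t), …, p_r(t)) ∈ ℝ^d`. -/
def gmc (d r : ℕ) (p : Fin r → ℝ → ℝ) (t : ℝ) : Fin d → ℝ :=
  fun i =>
    if h : (i : ℕ) < d - r then t ^ ((i : ℕ) + 1)
    else p ⟨(i : ℕ) - (d - r), by have h2 := i.2; omega⟩ t

/-- A polytope is `k`-neighborly if each subset of at most `k` of its vertices is the
vertex set of a face. -/
def IsNeighborly {d : ℕ} (k : ℕ) (P : Set (Fin d → ℝ)) : Prop :=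
  ∀ S : Finset (Fin d → ℝ), (S : Set (Fin d → ℝ)) ⊆ verts P → S.card ≤ k →
    ∃ G : Set (Fin d → ℝ), IsFaceOf P G ∧ verts G = (S : Set (Fin d → ℝ))

/-- The point `y` is beyond the facet `F` of the polytope `P`: for every supporting
hyperplane of `P` cutting out a facet, `y` is strictly on the outer side if the facet is `F`,
and strictly on the inner side otherwise. -/
def IsBeyond {d : ℕ} (P F : Set (Fin d → ℝ)) (y : Fin d → ℝ) : Prop :=
  ∀ (b : Fin d → ℝ) (c : ℝ), b ≠ 0 → (∀ x ∈ P, dotp b x ≤ c) →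
    IsFacetOf P {x ∈ P | dotp b x = c} →
      (({x ∈ P | dotp b x = c} = F → c < dotp b y) ∧
       ({x ∈ P | dotp b x = c} ≠ F → dotp b y < c))


lemma prod_sign {ι : Type*} (S : Finset ι) (f : ι → ℝ) :
    ∏ k ∈ S, f k = (-1) ^ (S.filter (fun k => f k < 0)).card * ∏ k ∈ S, |f k| := by
  have : ∀ k ∈ S, f k = (if f k < 0 then (-1:ℝ) else 1) * |f k| := by
    intro k _
    split_ifs with h
    · rw [abs_of_neg h]; ring
    · rw [abs_of_nonneg (not_lt.1 h)]; ring
  conv_lhs => rw [Finset.prod_congr rfl this]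
  rw [Finset.prod_mul_distrib, Finset.prod_ite]
  simp

/-- alternating sums -/
lemma alt_sum (w : ℕ → ℝ) (S : Finset ℕ) :
    (∀ i ∈ S, 0 ≤ w i) → (∀ i ∈ S, ∀ j ∈ S, i < j → w i ≤ w j) →
    0 ≤ ∑ i ∈ S, (-1) ^ (S.filter (fun k => i < k)).card * w i ∧
    (S.Nonempty → ∃ j ∈ S, ∑ i ∈ S, (-1) ^ (S.filter (fun k => i < k)).card * w i ≤ w j) := by
  induction S using Finset.induction_on_max with
  | empty => simp
  | insert a S hS ih =>
    intro h1 h2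
    have ha : a ∉ S := fun h => lt_irrefl _ (hS a h)
    obtain ⟨i1, i2⟩ := ih (fun i hi => h1 i (mem_insert_of_mem hi))
      (fun i hi j hj => h2 i (mem_insert_of_mem hi) j (mem_insert_of_mem hj))
    have key : ∑ i ∈ insert a S, (-1:ℝ) ^ ((insert a S).filter (fun k => i < k)).card * w i
        = w a - ∑ i ∈ S, (-1) ^ (S.filter (fun k => i < k)).card * w i := by
      rw [sum_insert ha, sub_eq_add_neg, ← Finset.sum_neg_distrib]
      congr 1
      · have : (insert a S).filter (fun k => a < k) = ∅ := by
          apply filter_false_of_mem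
          intro i hi
          rcases mem_insert.1 hi with rfl | hi
          · simp
          · exact (hS i hi).le.not_gt
        rw [this]; simp
      · apply sum_congr rfl
        intro i hi
        rw [filter_insert, if_pos (hS i hi), card_insert_of_notMem (by simp [ha]), pow_succ]
        ring
    rw [key]
    refine ⟨?_, fun _ => ⟨a, mem_insert_self a S, by linarith⟩⟩
    rcases S.eq_empty_or_nonempty with rfl | hne
    · simpa using h1 a (by simp)
    · obtain ⟨j, hj, hle⟩ := i2 hne
      have := h2 j (mem_insert_of_mem hj) a (mem_insert_self a S) (hS j hj)
      linarith

lemma alt_sum_pos (w : ℕ → ℝ) (S : Finset ℕ) (h1 : ∀ i ∈ S, 0 ≤ w i)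
    (h2 : ∀ i ∈ S, ∀ j ∈ S, i < j → w i ≤ w j) (a : ℕ) (ha : ∀ i ∈ S, i < a)
    (h3 : ∀ i ∈ S, w i < w a) (h4 : 0 < w a) :
    0 < ∑ i ∈ insert a S, (-1) ^ ((insert a S).filter (fun k => i < k)).card * w i := by
  have haS : a ∉ S := fun h => lt_irrefl _ (ha a h)
  obtain ⟨i1, i2⟩ := alt_sum w S h1 h2
  have key : ∑ i ∈ insert a S, (-1:ℝ) ^ ((insert a S).filter (fun k => i < k)).card * w i
        = w a - ∑ i ∈ S, (-1) ^ (S.filter (fun k => i < k)).card * w i := by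
      rw [sum_insert haS, sub_eq_add_neg, ← Finset.sum_neg_distrib]
      congr 1
      · have : (insert a S).filter (fun k => a < k) = ∅ := by
          apply filter_false_of_mem
          intro i hi
          rcases mem_insert.1 hi with rfl | hi
          · simp
          · exact (ha i hi).le.not_gt
        rw [this]; simp
      · apply sum_congr rfl
        intro i hi
        rw [filter_insert, if_pos (ha i hi), card_insert_of_notMem (by simp [haS]), pow_succ]
        ring
  rw [key]
  rcases S.eq_empty_or_nonempty with rfl | hne
  · simpa using h4
  · obtain ⟨j, hj, hle⟩ := i2 hne
    have := h3 j hj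
    linarith

/-- value of `p` at the points -/
def PP (e n s j : ℕ) : ℝ := acp (e+1) n s (acT (e+1) s j)

lemma PP_zero {e n s j : ℕ} (h : j < e+1+s) : PP e n s j = 0 := by
  unfold PP acp acT
  apply mul_eq_zero_of_right
  apply Finset.prod_eq_zero (i := e + s - j) (by simp; omega)
  rw [Nat.cast_sub (by omega)]
  push_cast; ring

lemma PP_pos {e n s j : ℕ} (hn : e+1+s < n) (h : e+1+s ≤ j) : 0 < PP e n s j := by
  unfold PP acp acT
  have h1 : (1:ℝ) < n := by exact_mod_cast (by omega : 1 < n)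
  have h2 : (e:ℝ)+1+s ≤ j := by exact_mod_cast h
  apply mul_pos
  · apply Real.rpow_pos_of_pos; linarith
  · apply Finset.prod_pos
    intro l _
    have : (0:ℝ) ≤ l := Nat.cast_nonneg l
    push_cast; linarith

lemma PP_nonneg {e n s j : ℕ} (hn : e+1+s < n) : 0 ≤ PP e n s j := by
  by_cases h : j < e+1+s
  · rw [PP_zero h]
  · exact (PP_pos hn (by omega)).le

lemma PP_lt {e n s i j : ℕ} (he : 1 ≤ e) (hn : e+1+s < n) (h : e+1+s ≤ j) (hij : i < j) :
    ((n:ℝ)-1)^e * PP e n s i < PP e n s j := by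
  by_cases hi : i < e+1+s
  · rw [PP_zero hi, mul_zero]; exact PP_pos hn h
  · have h1 : (2:ℝ) < n := by exact_mod_cast (by omega : 2 < n)
    have h2 : (e:ℝ)+1+s ≤ i := by exact_mod_cast (not_lt.1 hi)
    have h3 : (i:ℝ)+1 ≤ j := by exact_mod_cast hij
    have he' : (0:ℝ) ≤ e := Nat.cast_nonneg e
    unfold PP acp acT
    rw [← mul_assoc, ← Real.rpow_natCast, ← Real.rpow_add (by linarith)]
    apply mul_lt_mul'
    · apply Real.rpow_le_rpow_of_exponent_le (by linarith)
      push_cast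
      nlinarith
    · apply Finset.prod_lt_prod_of_nonempty
      · intro l _
        have : (0:ℝ) ≤ l := Nat.cast_nonneg l
        push_cast; linarith
      · intro l _
        push_cast; linarith
      · simp
    · apply Finset.prod_nonneg
      intro l _
      have : (0:ℝ) ≤ l := Nat.cast_nonneg l
      push_cast; linarith
    · apply Real.rpow_pos_of_pos; linarith

lemma PP_le {e n s i j : ℕ} (he : 1 ≤ e) (hn : e+1+s < n) (hij : i < j) :
    ((n:ℝ)-1)^e * PP e n s i ≤ PP e n s j := by
  by_cases h : e+1+s ≤ j
  · exact (PP_lt he hn h hij).le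
  · rw [PP_zero (by omega : i < e+1+s), mul_zero]; exact PP_nonneg hn

lemma prod_abs_pos (T : Finset ℕ) (i : ℕ) : 0 < ∏ k ∈ T.erase i, |(i:ℝ) - k| := by
  apply Finset.prod_pos
  intro k hk
  rw [abs_pos, sub_ne_zero]
  exact_mod_cast (ne_of_mem_erase hk).symm

lemma prod_abs_le {e n : ℕ} (T : Finset ℕ) (hT : T ⊆ range n) (hc : T.card = e+2)
    {i j : ℕ} (hi : i ∈ T) (hj : j ∈ T) (hij : i < j) :
    ∏ k ∈ T.erase j, |(j:ℝ) - k| ≤ ((n:ℝ)-1)^e * ∏ k ∈ T.erase i, |(i:ℝ) - k| := by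
  have hi' : i ∈ T.erase j := mem_erase.2 ⟨by omega, hi⟩
  have hj' : j ∈ T.erase i := mem_erase.2 ⟨by omega, hj⟩
  rw [← mul_prod_erase _ _ hi', ← mul_prod_erase _ _ hj', erase_right_comm, abs_sub_comm]
  have hcard : ((T.erase i).erase j).card = e := by
    rw [card_erase_of_mem hj', card_erase_of_mem hi]; omega
  have : ∏ k ∈ (T.erase i).erase j, |(j:ℝ) - k| ≤
      ((n:ℝ)-1)^e * ∏ k ∈ (T.erase i).erase j, |(i:ℝ) - k| := by
    rw [← hcard, ← Finset.prod_const, ← Finset.prod_mul_distrib]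
    apply Finset.prod_le_prod
    · intros; positivity
    · intro k hk
      have hkT : k < n := mem_range.1 (hT (mem_of_mem_erase (mem_of_mem_erase hk)))
      have hjT : j < n := mem_range.1 (hT hj)
      have hki : k ≠ i := ne_of_mem_erase (mem_of_mem_erase hk)
      have a1 : (k:ℝ) + 1 ≤ n := by exact_mod_cast hkT
      have a2 : (j:ℝ) + 1 ≤ n := by exact_mod_cast hjT
      have a3 : (0:ℝ) ≤ k := Nat.cast_nonneg k
      have a4 : (0:ℝ) ≤ j := Nat.cast_nonneg j
      have b1 : |(j:ℝ) - k| ≤ n - 1 := by rw [abs_le]; constructor <;> linarith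
      have b2 : (1:ℝ) ≤ |(i:ℝ) - k| := by
        have : (1:ℤ) ≤ |(i:ℤ) - k| := Int.one_le_abs (by omega)
        exact_mod_cast this
      nlinarith
  calc _ ≤ |(i:ℝ) - j| * (((n:ℝ)-1)^e * ∏ k ∈ (T.erase i).erase j, |(i:ℝ) - k|) := by gcongr
    _ = _ := by ring

/-- divided difference positivity -/
lemma dd_pos {e n s : ℕ} (he : 1 ≤ e) (hn : e+1+s < n) (T : Finset ℕ) (hT : T ⊆ range n)
    (hc : T.card = e+2) (hm : ¬ T ⊆ range (e+1+s)) :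
    0 < ∑ i ∈ T, PP e n s i / ∏ k ∈ T.erase i, ((i:ℝ) - k) := by
  set w : ℕ → ℝ := fun i => PP e n s i / ∏ k ∈ T.erase i, |(i:ℝ) - k| with hw
  have hterm : ∀ i ∈ T, PP e n s i / ∏ k ∈ T.erase i, ((i:ℝ) - k) =
      (-1) ^ (T.filter (fun k => i < k)).card * w i := by
    intro i hi
    have hf : (T.erase i).filter (fun k : ℕ => (i:ℝ) - k < 0) = T.filter (fun k => i < k) := by
      ext k
      simp only [mem_filter, mem_erase, sub_neg, Nat.cast_lt]
      constructor
      · rintro ⟨⟨_, h⟩, h'⟩; exact ⟨h, h'⟩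
      · rintro ⟨h, h'⟩; exact ⟨⟨by omega, h⟩, h'⟩
    rw [prod_sign, hf, hw]
    have hp := (prod_abs_pos T i).ne'
    rcases neg_one_pow_eq_or ℝ (T.filter (fun k => i < k)).card with h | h <;> rw [h]
    · simp
    · simp only []; field_simp
  rw [sum_congr rfl hterm]
  have hne : T.Nonempty := by rw [← card_pos]; omega
  set a := T.max' hne with ha
  have haT : a ∈ T := T.max'_mem hne
  have ham : e+1+s ≤ a := by
    obtain ⟨b, hb, hb'⟩ := not_subset.1 hm
    have := T.le_max' b hb
    simp at hb'
    omega
  have hlt : ∀ i ∈ T.erase a, i < a := fun i hi =>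
    lt_of_le_of_ne (T.le_max' i (mem_of_mem_erase hi)) (ne_of_mem_erase hi)
  rw [← insert_erase haT]
  apply alt_sum_pos w (T.erase a)
  · intro i hi
    exact div_nonneg (PP_nonneg hn) (prod_abs_pos T i).le
  · intro i hi j hj hij
    have hi' := mem_of_mem_erase hi
    have hj' := mem_of_mem_erase hj
    rw [hw]; simp only []
    rw [div_le_div_iff₀ (prod_abs_pos T i) (prod_abs_pos T j)]
    have h1 := prod_abs_le T hT hc hi' hj' hij
    have h2 := PP_le he hn hij (s := s)
    have h3 := prod_abs_pos T i
    calc _ ≤ PP e n s i * (((n:ℝ)-1)^e * ∏ k ∈ T.erase i, |(i:ℝ) - k|) :=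
          mul_le_mul_of_nonneg_left h1 (PP_nonneg hn)
      _ = (((n:ℝ)-1)^e * PP e n s i) * ∏ k ∈ T.erase i, |(i:ℝ) - k| := by ring
      _ ≤ _ := mul_le_mul_of_nonneg_right h2 h3.le
  · exact hlt
  · intro i hi
    have hi' := mem_of_mem_erase hi
    rw [hw]; simp only []
    rw [div_lt_div_iff₀ (prod_abs_pos T i) (prod_abs_pos T a)]
    have h1 := prod_abs_le T hT hc hi' haT (hlt i hi)
    have h2 := PP_lt he hn ham (hlt i hi)
    have h3 := prod_abs_pos T i
    calc _ ≤ PP e n s i * (((n:ℝ)-1)^e * ∏ k ∈ T.erase i, |(i:ℝ) - k|) :=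
          mul_le_mul_of_nonneg_left h1 (PP_nonneg hn)
      _ = (((n:ℝ)-1)^e * PP e n s i) * ∏ k ∈ T.erase i, |(i:ℝ) - k| := by ring
      _ < _ := mul_lt_mul_of_pos_right h2 h3
  · exact div_pos (PP_pos hn ham) (prod_abs_pos T a)

def GS (r n d : ℕ) : Finset (Finset ℕ) :=
  (powersetCard d (range n)).filter
    (fun S => ∀ j < n, j ∉ S → (S.filter (fun i => i < j)).card % 2 = r)

lemma mem_GS {r n d : ℕ} {S : Finset ℕ} : S ∈ GS r n d ↔ (S ⊆ range n ∧ S.card = d) ∧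
    ∀ j < n, j ∉ S → (S.filter (fun i => i < j)).card % 2 = r := by
  simp [GS, mem_powersetCard]

lemma GS_zero_zero (n : ℕ) : (GS 0 n 0).card = 1 := by
  have : GS 0 n 0 = {∅} := by
    ext S
    rw [mem_GS, Finset.card_eq_zero, mem_singleton]
    constructor
    · rintro ⟨⟨_, h⟩, _⟩; exact h
    · rintro rfl; simp
  rw [this]; simp

lemma GS_one_zero (n : ℕ) : (GS 1 (n+1) 0).card = 0 := by
  rw [Finset.card_eq_zero, Finset.eq_empty_iff_forall_notMem]
  intro S hS
  rw [mem_GS, Finset.card_eq_zero] at hS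
  obtain ⟨⟨_, rfl⟩, h⟩ := hS
  have := h 0 (by omega) (by simp)
  simp at this

lemma GS_lt {r n d : ℕ} (h : n < d) : (GS r n d).card = 0 := by
  rw [Finset.card_eq_zero, Finset.eq_empty_iff_forall_notMem]
  intro S hS
  rw [mem_GS] at hS
  have := card_le_card hS.1.1
  simp at this; omega

lemma filt_top {n : ℕ} {S : Finset ℕ} (hS : S ⊆ range n) {j : ℕ} (h : n ≤ j) :
    S.filter (fun i => i < j) = S := by
  apply filter_true_of_mem
  intro i hi
  have := mem_range.1 (hS hi); omega

lemma GS_succ (r n d : ℕ) : (GS r (n+1) (d+1)).card =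
    (GS r n d).card + if (d+1) % 2 = r then (GS r n (d+1)).card else 0 := by
  have key : GS r (n+1) (d+1) = ((GS r n d).image (insert n)) ∪
      (if (d+1) % 2 = r then GS r n (d+1) else ∅) := by
    ext S
    rw [mem_union, mem_image]
    constructor
    · intro hS
      rw [mem_GS] at hS
      obtain ⟨⟨h1, h2⟩, h3⟩ := hS
      by_cases hn : n ∈ S
      · left
        refine ⟨S.erase n, ?_, insert_erase hn⟩
        rw [mem_GS]
        refine ⟨⟨?_, by rw [card_erase_of_mem hn]; omega⟩, ?_⟩
        · intro i hi
          have := h1 (mem_of_mem_erase hi)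
          have := ne_of_mem_erase hi
          simp at *; omega
        · intro j hj hjS
          rw [← h3 j (by omega) (fun h => hjS (mem_erase.2 ⟨by omega, h⟩))]
          congr 2
          ext i; simp; intro h _; omega
      · right
        have hsub : S ⊆ range n := by
          intro i hi
          have := h1 hi
          have : i ≠ n := by rintro rfl; exact hn hi
          simp at *; omega
        have h4 := h3 n (by omega) hn
        rw [filt_top hsub le_rfl, h2] at h4
        rw [if_pos h4, mem_GS]
        exact ⟨⟨hsub, h2⟩, fun j hj => h3 j (by omega)⟩
    · rintro (⟨S', hS', rfl⟩ | hS)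
      · rw [mem_GS] at hS' ⊢
        obtain ⟨⟨h1, h2⟩, h3⟩ := hS'
        have hn : n ∉ S' := fun h => by simpa using h1 h
        refine ⟨⟨?_, by rw [card_insert_of_notMem hn, h2]⟩, ?_⟩
        · intro i hi
          rcases mem_insert.1 hi with rfl | hi
          · simp
          · have := h1 hi
            simp at *; omega
        · intro j hj hjS
          rw [mem_insert, not_or] at hjS
          rw [← h3 j (by omega) hjS.2, filter_insert, if_neg (by omega)]
      · split_ifs at hS with hr
        · rw [mem_GS] at hS ⊢
          obtain ⟨⟨h1, h2⟩, h3⟩ := hS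
          refine ⟨⟨h1.trans (range_mono (by omega)), h2⟩, ?_⟩
          intro j hj hjS
          by_cases hjn : j = n
          · rw [filt_top h1 hjn.ge, h2, hr]
          · exact h3 j (by omega) hjS
        · simp at hS
  rw [key, card_union_of_disjoint, card_image_of_injOn]
  · split_ifs <;> simp
  · intro S hS T hT h
    rw [mem_coe, mem_GS] at hS hT
    have h1 : n ∉ S := fun h => by simpa using hS.1.1 h
    have h2 : n ∉ T := fun h => by simpa using hT.1.1 h
    have := congrArg (fun U => U.erase n) h
    simpa [erase_insert h1, erase_insert h2] using this
  · rw [disjoint_left]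
    intro S hS hT
    obtain ⟨S', _, rfl⟩ := mem_image.1 hS
    split_ifs at hT
    · rw [mem_GS] at hT
      have := hT.1.1 (mem_insert_self n S')
      simp at this
    · simp at hT

lemma GS0_odd (k a : ℕ) : (GS 0 (2*k+1+a) (2*k+1)).card = (GS 0 (2*k+a) (2*k)).card := by
  rw [show 2*k+1+a = (2*k+a)+1 by ring, GS_succ, if_neg (by omega)]; rfl

lemma GS0_even (k a : ℕ) : (GS 0 (2*k+a) (2*k)).card = (k+a).choose k := by
  induction k generalizing a with
  | zero => simp [GS_zero_zero]
  | succ k ih =>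
    induction a with
    | zero =>
      rw [Nat.add_zero, show 2*(k+1) = (2*k+1)+1 by ring, GS_succ,
        if_pos (by omega), GS_lt (n := 2*k+1) (d := 2*k+1+1) (by omega)]
      have := GS0_odd k 0
      rw [ih 0] at this
      simpa using this
    | succ a iha =>
      rw [show 2*(k+1)+(a+1) = (2*k+1+(a+1))+1 by ring, show 2*(k+1) = (2*k+1)+1 by ring, GS_succ,
        if_pos (by omega), GS0_odd, ih]
      rw [show 2*(k+1) + a = 2*k+1+(a+1) by ring, show 2*(k+1) = (2*k+1)+1 by ring] at iha
      rw [iha, show k+1+(a+1) = (k+a+1)+1 by ring, Nat.choose_succ_succ]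
      congr 2; ring

lemma GS1_even (k a : ℕ) : (GS 1 (2*k+2+a) (2*k+2)).card = (GS 1 (2*k+1+a) (2*k+1)).card := by
  rw [show 2*k+2+a = (2*k+1+a)+1 by ring, show 2*k+2 = (2*k+1)+1 by ring, GS_succ,
    if_neg (by omega)]; rfl

lemma GS1_odd (k a : ℕ) : (GS 1 (2*k+1+a) (2*k+1)).card = (k+a).choose k := by
  induction k generalizing a with
  | zero =>
    induction a with
    | zero =>
      have h : (GS 1 0 0).card = 1 := by
        have : GS 1 0 0 = {∅} := by
          ext S
          rw [mem_GS, Finset.card_eq_zero, mem_singleton]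
          constructor
          · rintro ⟨⟨_, h⟩, _⟩; exact h
          · rintro rfl; simp
        rw [this]; simp
      rw [show 2*0+1+0 = 0+1 by ring, show 2*0+1 = 0+1 by ring, GS_succ, if_pos (by omega),
        GS_lt (n := 0) (d := 0+1) (by omega), h]; simp
    | succ a iha =>
      rw [show 2*0+1+(a+1) = (a+1)+1 by ring, GS_succ, if_pos (by omega), GS_one_zero]
      rw [show 2*0+1+a = a+1 by ring] at iha
      rw [iha]; simp
  | succ k ih =>
    induction a with
    | zero =>
      rw [Nat.add_zero, show 2*(k+1)+1 = (2*k+2)+1 by ring, GS_succ,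
        if_pos (by omega), GS_lt (n := 2*k+2) (d := 2*k+2+1) (by omega)]
      have := GS1_even k 0
      rw [ih 0] at this
      simpa using this
    | succ a iha =>
      rw [show 2*(k+1)+1+(a+1) = (2*k+2+(a+1))+1 by ring, show 2*(k+1)+1 = (2*k+2)+1 by ring,
        GS_succ, if_pos (by omega), GS1_even, ih]
      rw [show 2*(k+1)+1 + a = 2*k+2+(a+1) by ring, show 2*(k+1)+1 = (2*k+2)+1 by ring] at iha
      rw [iha, show k+1+(a+1) = (k+a+1)+1 by ring, Nat.choose_succ_succ]
      congr 2; ring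

def TS (n m d : ℕ) : Finset (Finset ℕ) :=
  (GS 0 n d ∪ GS 1 n d).filter (fun S => ¬ S ⊆ range m)

lemma TS_card (n m d : ℕ) (hm : m < n) (hd : d % 2 = 0) (hdn : d < n) :
    (TS n m d).card + (GS 0 m d).card = (GS 0 n d).card + (GS 1 n d).card := by
  have h1 : (GS 0 n d ∪ GS 1 n d).card = (GS 0 n d).card + (GS 1 n d).card := by
    apply card_union_of_disjoint
    rw [disjoint_left]
    intro S h0 h1
    rw [mem_GS] at h0 h1
    have : ¬ range n ⊆ S := fun h => by
      have := card_le_card h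
      simp at this; omega
    obtain ⟨j, hj, hjS⟩ := not_subset.1 this
    have a := h0.2 j (mem_range.1 hj) hjS
    have b := h1.2 j (mem_range.1 hj) hjS
    omega
  rw [← h1, ← card_filter_add_card_filter_not (s := GS 0 n d ∪ GS 1 n d) (fun S => ¬ S ⊆ range m)]
  congr 2
  ext S
  rw [mem_filter, mem_union, mem_GS, mem_GS, mem_GS, not_not]
  constructor
  · rintro ⟨⟨h1, h2⟩, h3⟩
    refine ⟨Or.inl ⟨⟨h1.trans (range_mono hm.le), h2⟩, ?_⟩, h1⟩
    intro j hj hjS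
    by_cases hjm : j < m
    · exact h3 j hjm hjS
    · rw [filt_top h1 (by omega), h2, hd]
  · rintro ⟨h | h, hs⟩
    · exact ⟨⟨hs, h.1.2⟩, fun j hj => h.2 j (by omega)⟩
    · have := h.2 m hm (fun h => by simpa using hs h)
      rw [filt_top hs le_rfl, h.1.2] at this
      omega

lemma count_final (k n s : ℕ) (hk : 1 ≤ k) (hn : 2*k + s < n) :
    ((TS n (2*k+s) (2*k)).card : ℤ) = ((n - k - 1).choose k : ℤ)
        + 2 * ∑ i ∈ Finset.range k, ((n - 2*k - 1 + i).choose i : ℤ)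
        - ((s + k).choose k : ℤ) := by
  have h := TS_card n (2*k+s) (2*k) hn (by omega) (by omega)
  rw [GS0_even] at h
  obtain ⟨k, rfl⟩ : ∃ k', k = k' + 1 := ⟨k-1, by omega⟩
  obtain ⟨a, rfl⟩ : ∃ a, n = 2*(k+1)+(a+1) := ⟨n - 2*(k+1) - 1, by omega⟩
  rw [GS0_even, show 2*(k+1)+(a+1) = 2*k+2+(a+1) by ring, show 2*(k+1) = 2*k+2 by ring, GS1_even,
    GS1_odd] at h
  have hs : ∑ i ∈ Finset.range (k+1), (a + i).choose i = (k+a+1).choose k := by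
    clear h
    induction k with
    | zero => simp
    | succ k ih =>
      rw [Finset.sum_range_succ, ih (by omega) (by omega), show k+1+a+1 = (k+a+1)+1 by ring,
        Nat.choose_succ_succ]
      congr 2; ring
  rw [show 2*(k+1)+(a+1) = 2*k+2+(a+1) by ring, show 2*(k+1) = 2*k+2 by ring]
  rw [show 2*k+2+(a+1) - (k+1) - 1 = k+a+1 by omega, show 2*k+2+(a+1) - (2*k+2) - 1 = a by omega]
  have hs' : ∑ i ∈ Finset.range (k+1), ((a + i).choose i : ℤ) = (k+a+1).choose k := by
    exact_mod_cast hs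
  rw [hs']
  have e1 : k + 1 + (a+1) = (k+a+1)+1 := by ring
  rw [e1, Nat.choose_succ_succ, show k + (a+1) = k+a+1 by ring, show k+1+s = s+(k+1) by ring] at h
  zify at h
  linarith

/-- the points, indexed by naturals -/
def YY (e n s j : ℕ) : Fin (e+1) → ℝ := acy (e+1) n s (acT (e+1) s j)

def dl {d : ℕ} (b : Fin d → ℝ) : (Fin d → ℝ) →ₗ[ℝ] ℝ where
  toFun := dotp b
  map_add' x y := by simp [dotp, mul_add, sum_add_distrib]
  map_smul' r x := by
    simp only [dotp, Pi.smul_apply, smul_eq_mul, RingHom.id_apply, mul_sum]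
    exact sum_congr rfl fun i _ => by ring

lemma dl_apply {d : ℕ} (b x : Fin d → ℝ) : dl b x = dotp b x := rfl

open Polynomial in
def RR {e : ℕ} (b : Fin (e+1) → ℝ) (c : ℝ) : ℝ[X] :=
  ∑ i : Fin e, C (b i.castSucc) * X ^ ((i:ℕ)+1) - C c

lemma gg_eq {e n s j : ℕ} (b : Fin (e+1) → ℝ) (c : ℝ) :
    dotp b (YY e n s j) - c =
      (RR b c).eval (acT (e+1) s j) + b (Fin.last e) * PP e n s j := by
  unfold dotp RR YY acy PP
  rw [Fin.sum_univ_castSucc]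
  simp only [Polynomial.eval_sub, Polynomial.eval_finsetSum, Polynomial.eval_mul,
    Polynomial.eval_C, Polynomial.eval_pow, Polynomial.eval_X, Fin.val_last, if_true,
    Fin.val_castSucc]
  have : ∀ i : Fin e, ¬ ((i:ℕ) + 1 = e + 1) := fun i => by have := i.2; omega
  simp only [this, if_false]
  ring

lemma RR_degree {e : ℕ} (b : Fin (e+1) → ℝ) (c : ℝ) : (RR b c).degree < ((e+1 : ℕ) : WithBot ℕ) := by
  unfold RR
  apply lt_of_le_of_lt (Polynomial.degree_sub_le _ _)
  apply max_lt
  · rw [Polynomial.degree_lt_iff_coeff_zero]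
    intro m hm
    rw [Polynomial.finsetSum_coeff]
    apply Finset.sum_eq_zero
    intro i _
    rw [Polynomial.coeff_C_mul_X_pow, if_neg]
    have := i.2; omega
  · apply lt_of_le_of_lt Polynomial.degree_C_le
    exact_mod_cast Nat.succ_pos e

lemma RR_zero {e : ℕ} {b : Fin (e+1) → ℝ} {c : ℝ} (h : RR b c = 0) :
    (∀ i : Fin e, b i.castSucc = 0) ∧ c = 0 := by
  constructor
  · intro i
    have := congrArg (fun p => Polynomial.coeff p ((i:ℕ)+1)) h
    simp only [RR, Polynomial.coeff_sub, Polynomial.finsetSum_coeff,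
      Polynomial.coeff_C_mul_X_pow, Polynomial.coeff_C_succ, Polynomial.coeff_zero, sub_zero] at this
    rw [Finset.sum_eq_single i] at this
    · simpa using this
    · intro k _ hk
      rw [if_neg]
      intro h'
      apply hk
      ext; omega
    · simp
  · have := congrArg (fun p => Polynomial.coeff p 0) h
    simp only [RR, Polynomial.coeff_sub, Polynomial.finsetSum_coeff,
      Polynomial.coeff_C_mul_X_pow, Polynomial.coeff_C_zero, Polynomial.coeff_zero] at this
    rw [Finset.sum_eq_zero (fun i _ => by rw [if_neg (by omega)])] at this
    linarith

lemma acT_inj (d s : ℕ) (S : Set ℕ) : Set.InjOn (acT d s) S := by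
  intro i _ j _ h
  unfold acT at h
  have : (i:ℝ) = j := by linarith
  exact_mod_cast this

lemma acT_sub (d s i j : ℕ) : acT d s i - acT d s j = (i:ℝ) - j := by
  unfold acT; ring

lemma RR_eq_zero {e n s : ℕ} {b : Fin (e+1) → ℝ} {c : ℝ} {S : Finset ℕ} (hS : e+1 ≤ S.card)
    (hv : ∀ i ∈ S, dotp b (YY e n s i) = c)
    (hz : ∀ i ∈ S, b (Fin.last e) * PP e n s i = 0) : RR b c = 0 := by
  apply Polynomial.eq_zero_of_degree_lt_of_eval_index_eq_zero (s := S) (v := acT (e+1) s) (acT_inj _ _ _)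
  · apply lt_of_lt_of_le (RR_degree b c)
    exact_mod_cast hS
  · intro i hi
    have := gg_eq (n := n) (s := s) (j := i) b c
    rw [hv i hi, hz i hi] at this
    linarith

lemma b_zero {e : ℕ} {b : Fin (e+1) → ℝ} {c : ℝ} (h : RR b c = 0) (hl : b (Fin.last e) = 0) :
    b = 0 := by
  funext i
  induction i using Fin.lastCases with
  | last => exact hl
  | cast i => exact (RR_zero h).1 i

def DD (e n s : ℕ) (T : Finset ℕ) : ℝ := ∑ i ∈ T, PP e n s i / ∏ k ∈ T.erase i, ((i:ℝ) - k)

lemma main_eq {e n s : ℕ} {b : Fin (e+1) → ℝ} {c : ℝ} {S : Finset ℕ} (hS : S.card = e+1)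
    (hv : ∀ i ∈ S, dotp b (YY e n s i) = c) {j : ℕ} (hj : j ∉ S) :
    dotp b (YY e n s j) - c =
      b (Fin.last e) * (∏ i ∈ S, ((j:ℝ) - i)) * DD e n s (insert j S) := by
  have hR : RR b c = Lagrange.interpolate S (acT (e+1) s)
      (fun i => - (b (Fin.last e) * PP e n s i)) := by
    apply Lagrange.eq_interpolate_of_eval_eq _ (acT_inj _ _ _)
    · rw [hS]; exact RR_degree b c
    · intro i hi
      have := gg_eq (n := n) (s := s) (j := i) b c
      rw [hv i hi] at this
      linarith
  have hne : ∀ i ∈ S, (j:ℝ) - i ≠ 0 := by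
    intro i hi
    rw [sub_ne_zero]
    rintro h
    have h : j = i := by exact_mod_cast h
    exact hj (h ▸ hi)
  rw [gg_eq, hR, Lagrange.eval_interpolate_not_at_node, Lagrange.eval_nodal, DD, sum_insert hj,
    erase_insert hj]
  · simp only [acT_sub, Lagrange.nodalWeight]
    have hp : ∏ i ∈ S, ((j:ℝ) - i) ≠ 0 := prod_ne_zero_iff.2 hne
    have : ∀ i ∈ S, PP e n s i / ∏ k ∈ (insert j S).erase i, ((i:ℝ) - k) =
        - ((∏ k ∈ S.erase i, ((i:ℝ) - k)⁻¹) * ((j:ℝ) - i)⁻¹ * PP e n s i) := by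
      intro i hi
      have hij : j ≠ i := by rintro rfl; exact hj hi
      rw [erase_insert_of_ne hij, prod_insert (by simp [hj]), prod_inv_distrib,
        div_eq_mul_inv, mul_inv, ← neg_sub (j:ℝ) i, inv_neg]
      ring
    rw [sum_congr rfl this, sum_neg_distrib, mul_add, mul_comm (b (Fin.last e)), mul_assoc,
      mul_assoc]
    have h2 : ∑ x ∈ S, (∏ k ∈ S.erase x, ((x:ℝ) - k)⁻¹) * ((j:ℝ) - x)⁻¹ *
        -(b (Fin.last e) * PP e n s x) = - b (Fin.last e) *
        ∑ x ∈ S, (∏ k ∈ S.erase x, ((x:ℝ) - k)⁻¹) * ((j:ℝ) - x)⁻¹ * PP e n s x := by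
      rw [mul_sum]; exact sum_congr rfl fun i _ => by ring
    rw [h2]
    field_simp
    ring
  · intro i hi h
    apply hne i hi
    rw [← acT_sub (e+1) s, h, sub_self]

lemma exists_func {e n s : ℕ} (β : ℝ) {S : Finset ℕ} (hS : S.card = e+1) :
    ∃ (b : Fin (e+1) → ℝ) (c : ℝ), b (Fin.last e) = β ∧ ∀ i ∈ S, dotp b (YY e n s i) = c := by
  set q := Lagrange.interpolate S (acT (e+1) s) (PP e n s) with hq
  have hdeg : q.degree < ((e+1:ℕ) : WithBot ℕ) := by
    rw [← hS]; exact Lagrange.degree_interpolate_lt _ (acT_inj _ _ _)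
  have hnat : q.natDegree < e+1 := by
    by_cases h0 : q = 0
    · rw [h0]; simp
    · exact (Polynomial.natDegree_lt_iff_degree_lt h0).2 hdeg
  refine ⟨Fin.snoc (α := fun _ => ℝ) (fun i : Fin e => -β * q.coeff ((i:ℕ)+1)) β, β * q.coeff 0,
    by simp, ?_⟩
  intro i hi
  have h1 : q.eval (acT (e+1) s i) = PP e n s i := Lagrange.eval_interpolate_at_node _ (acT_inj _ _ _) hi
  rw [Polynomial.eval_eq_sum_range' hnat, sum_range_succ', Finset.sum_range] at h1
  rw [← sub_eq_zero, gg_eq]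
  simp only [RR, Polynomial.eval_sub, Polynomial.eval_finsetSum, Polynomial.eval_mul,
    Polynomial.eval_C, Polynomial.eval_pow, Polynomial.eval_X, Fin.snoc_castSucc, Fin.snoc_last]
  rw [← h1, mul_add, mul_sum]
  simp only [pow_zero, mul_one]
  have : ∑ x : Fin e, -β * q.coeff ((x:ℕ)+1) * acT (e+1) s i ^ ((x:ℕ)+1) =
     - ∑ x : Fin e, β * (q.coeff ((x:ℕ)+1) * acT (e+1) s i ^ ((x:ℕ)+1)) := by
    rw [← sum_neg_distrib]; exact sum_congr rfl fun i _ => by ring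
  rw [this]; ring

lemma DD_pos {e n s : ℕ} (he : 1 ≤ e) (hn : e+1+s < n) {S : Finset ℕ} (hS : S ⊆ range n)
    (hc : S.card = e+1) (hm : ¬ S ⊆ range (e+1+s)) {j : ℕ} (hj : j < n) (hjS : j ∉ S) :
    0 < DD e n s (insert j S) := by
  apply dd_pos he hn
  · exact insert_subset (mem_range.2 hj) hS
  · rw [card_insert_of_notMem hjS, hc]
  · exact fun h => hm ((subset_insert j S).trans h)

lemma T_card {e n s : ℕ} (he : 1 ≤ e) (hn : e+1+s < n) {b : Fin (e+1) → ℝ} {c : ℝ} (hb : b ≠ 0)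
    {T : Finset ℕ} (hT : T ⊆ range n) (hv : ∀ i ∈ T, dotp b (YY e n s i) = c)
    (hc : e+1 ≤ T.card) (hm : ¬ T ⊆ range (e+1+s)) : b (Fin.last e) ≠ 0 ∧ T.card = e+1 := by
  have hbl : b (Fin.last e) ≠ 0 := by
    intro h
    exact hb (b_zero (RR_eq_zero hc hv (fun i _ => by rw [h, zero_mul])) h)
  refine ⟨hbl, ?_⟩
  obtain ⟨x, hx, hx'⟩ := not_subset.1 hm
  obtain ⟨S, hS1, hS2, hS3⟩ := exists_subsuperset_card_eq (singleton_subset_iff.2 hx)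
    (by simp : ({x} : Finset ℕ).card ≤ e+1) hc
  by_contra hne
  have : ¬ T ⊆ S := fun h => by
    have := card_le_card h; omega
  obtain ⟨j, hj, hjS⟩ := not_subset.1 this
  have h1 := main_eq hS3 (fun i hi => hv i (hS2 hi)) hjS
  have h2 := DD_pos he hn (hS2.trans hT) hS3 (fun h => hx' (h (hS1 (mem_singleton_self x))))
    (mem_range.1 (hT hj)) hjS
  rw [hv j hj, sub_self] at h1
  have h3 : ∏ i ∈ S, ((j:ℝ) - i) ≠ 0 := by
    rw [prod_ne_zero_iff]
    intro i hi
    rw [sub_ne_zero]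
    rintro h
    have h : j = i := by exact_mod_cast h
    exact hjS (h ▸ hi)
  exact (mul_ne_zero (mul_ne_zero hbl h3) h2.ne') h1.symm

lemma prod_par {S : Finset ℕ} (hS : S.card % 2 = 0) {j : ℕ} (hj : j ∉ S) :
    ((S.filter (fun i => i < j)).card % 2 = 0 → 0 < ∏ i ∈ S, ((j:ℝ) - i)) ∧
    ((S.filter (fun i => i < j)).card % 2 = 1 → ∏ i ∈ S, ((j:ℝ) - i) < 0) := by
  have h1 : ∏ i ∈ S, ((j:ℝ) - i) = ∏ i ∈ S, ((i:ℝ) - j) := by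
    have : ∀ i ∈ S, ((j:ℝ) - i) = (-1) * ((i:ℝ) - j) := fun i _ => by ring
    rw [prod_congr rfl this, prod_mul_distrib, prod_const, Even.neg_one_pow (Nat.even_iff.2 hS),
      one_mul]
  have h2 : S.filter (fun i : ℕ => (i:ℝ) - j < 0) = S.filter (fun i => i < j) := by
    ext i; simp
  have h3 : 0 < ∏ i ∈ S, |(i:ℝ) - j| := by
    apply prod_pos
    intro i hi
    rw [abs_pos, sub_ne_zero]
    intro h
    have h : i = j := by exact_mod_cast h
    exact hj (h ▸ hi)
  rw [h1, prod_sign, h2]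
  constructor
  · intro h
    rw [Even.neg_one_pow (Nat.even_iff.2 h)]; linarith
  · intro h
    rw [Odd.neg_one_pow (Nat.odd_iff.2 h)]; linarith

lemma face_eq {d : ℕ} (Y : ℕ → Fin d → ℝ) (I : Finset ℕ) (b : Fin d → ℝ) (c : ℝ)
    (h : ∀ i ∈ I, dotp b (Y i) ≤ c) :
    {x ∈ convexHull ℝ (Y '' (I : Set ℕ)) | dotp b x = c} =
      convexHull ℝ (Y '' ((I.filter (fun i => dotp b (Y i) = c) : Finset ℕ) : Set ℕ)) := by
  classical
  apply Set.Subset.antisymm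
  · rintro x ⟨hx, hxc⟩
    rw [← coe_image, Finset.mem_convexHull'] at hx
    obtain ⟨w, hw0, hw1, hwx⟩ := hx
    have hle : ∀ y ∈ I.image Y, dotp b y ≤ c := by
      intro y hy
      obtain ⟨i, hi, rfl⟩ := mem_image.1 hy
      exact h i hi
    have hsum : ∑ y ∈ I.image Y, w y * (c - dotp b y) = 0 := by
      have e1 : dotp b x = ∑ y ∈ I.image Y, w y * dotp b y := by
        rw [← hwx, ← dl_apply, map_sum]
        exact sum_congr rfl fun y _ => by rw [map_smul, dl_apply, smul_eq_mul]
      simp only [mul_sub, sum_sub_distrib]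
      rw [← e1, ← sum_mul, hw1, hxc]; ring
    rw [sum_eq_zero_iff_of_nonneg (fun y hy => mul_nonneg (hw0 y hy) (by linarith [hle y hy]))]
      at hsum
    have hz : ∀ y ∈ I.image Y, dotp b y ≠ c → w y = 0 := by
      intro y hy hyc
      rcases mul_eq_zero.1 (hsum y hy) with h | h
      · exact h
      · exact absurd (by linarith) hyc
    have e2 : ∑ y ∈ (I.image Y).filter (fun y => dotp b y = c), w y = 1 := by
      rw [← hw1]
      apply sum_subset (filter_subset _ _)
      intro y hy hy'
      exact hz y hy (fun hh => hy' (mem_filter.2 ⟨hy, hh⟩))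
    have e3 : ∑ y ∈ (I.image Y).filter (fun y => dotp b y = c), w y • y = x := by
      rw [← hwx]
      apply sum_subset (filter_subset _ _)
      intro y hy hy'
      rw [hz y hy (fun hh => hy' (mem_filter.2 ⟨hy, hh⟩)), zero_smul]
    rw [← e3]
    apply (convex_convexHull ℝ _).sum_mem
    · intro y hy; exact hw0 y (mem_filter.1 hy).1
    · exact e2
    · intro y hy
      apply subset_convexHull
      obtain ⟨hy1, hy2⟩ := mem_filter.1 hy
      obtain ⟨i, hi, rfl⟩ := mem_image.1 hy1
      exact ⟨i, by simp [hi, hy2], rfl⟩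
  · apply convexHull_min
    · rintro _ ⟨i, hi, rfl⟩
      have hi := mem_filter.1 (mem_coe.1 hi)
      exact ⟨subset_convexHull _ _ ⟨i, hi.1, rfl⟩, hi.2⟩
    · apply (convex_convexHull ℝ _).inter
      exact convex_hyperplane (dl b).isLinear c

lemma conv_eq {d : ℕ} (Y : ℕ → Fin d → ℝ) (I : Finset ℕ) (b : Fin d → ℝ) (c : ℝ)
    (h : ∀ i ∈ I, dotp b (Y i) = c) {x : Fin d → ℝ} (hx : x ∈ convexHull ℝ (Y '' (I : Set ℕ))) :
    dotp b x = c := by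
  have : convexHull ℝ (Y '' (I : Set ℕ)) ⊆ {x | dotp b x = c} := by
    apply convexHull_min
    · rintro _ ⟨i, hi, rfl⟩
      exact h i hi
    · exact convex_hyperplane (dl b).isLinear c
  exact this hx

lemma polyDim_conv {d : ℕ} (A : Set (Fin d → ℝ)) :
    polyDim (convexHull ℝ A) = Module.finrank ℝ (vectorSpan ℝ A) := by
  unfold polyDim
  rw [affineSpan_convexHull, direction_affineSpan]

lemma dim_le {d : ℕ} (Y : ℕ → Fin d → ℝ) (T : Finset ℕ) (hT : T.Nonempty) :
    polyDim (convexHull ℝ (Y '' (T : Set ℕ))) + 1 ≤ T.card := by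
  classical
  rw [polyDim_conv, ← coe_image]
  have hp := card_pos.2 hT
  have := finrank_vectorSpan_image_finset_le ℝ Y T (n := T.card - 1) (by omega)
  omega

lemma aff_ind {e n s : ℕ} (S : Finset ℕ) (hS : S.card = e+1) :
    AffineIndependent ℝ (fun i : S => YY e n s i) := by
  rw [affineIndependent_iff]
  intro U w h0 h1 x hx
  set q := Lagrange.basis S (acT (e+1) s) (x:ℕ) with hq
  have hnat : q.natDegree < e+1 := by
    have hd := Lagrange.degree_basis (acT_inj (e+1) s (S : Set ℕ)) x.2
    rw [← hq, hS] at hd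
    rw [Polynomial.natDegree_eq_of_degree_eq_some hd]
    omega
  have hqs : ∑ y ∈ U, w y * q.eval (acT (e+1) s y) = 0 := by
    have : ∀ y ∈ U, w y * q.eval (acT (e+1) s y) =
        ∑ i : Fin e, q.coeff ((i:ℕ)+1) * (w y * YY e n s y i.castSucc) + q.coeff 0 * w y := by
      intro y _
      rw [Polynomial.eval_eq_sum_range' hnat, sum_range_succ', Finset.sum_range, mul_add, mul_sum]
      congr 1
      · apply sum_congr rfl
        intro i _
        have : ¬ ((i:ℕ) + 1 = e + 1) := by have := i.2; omega
        simp only [YY, acy, Fin.val_castSucc, this, if_false]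
        ring
      · simp; ring
    rw [sum_congr rfl this, sum_add_distrib, ← mul_sum, h0, mul_zero, add_zero, sum_comm]
    apply sum_eq_zero
    intro i _
    rw [← mul_sum]
    have := congrFun h1 i.castSucc
    simp only [Finset.sum_apply, Pi.smul_apply, smul_eq_mul, Pi.zero_apply] at this
    rw [this, mul_zero]
  rw [Finset.sum_eq_single x] at hqs
  · rw [hq, Lagrange.eval_basis_self (acT_inj _ _ _) x.2, mul_one] at hqs
    exact hqs
  · intro y _ hy
    rw [hq, Lagrange.eval_basis_of_ne (fun h => hy (Subtype.ext h.symm)) y.2, mul_zero]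
  · intro h; exact absurd hx h

lemma dim_eq {e n s : ℕ} (S : Finset ℕ) (hS : S.card = e+1) :
    polyDim (convexHull ℝ (YY e n s '' (S : Set ℕ))) = e := by
  rw [polyDim_conv]
  have := (aff_ind (n := n) (s := s) S hS).finrank_vectorSpan (n := e) (by simp [hS])
  have hr : YY e n s '' (S : Set ℕ) = Set.range (fun i : S => YY e n s i) := by
    ext x; simp
  rw [hr]
  exact this

lemma P_eq (e n s : ℕ) : acPolytope (e+1) n s = convexHull ℝ (YY e n s '' (range n : Set ℕ)) := by
  unfold acPolytope
  congr 1
  ext x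
  constructor
  · rintro ⟨j, rfl⟩
    exact ⟨j, by simp, rfl⟩
  · rintro ⟨j, hj, rfl⟩
    exact ⟨⟨j, by simpa using hj⟩, rfl⟩

lemma F_eq (e n s : ℕ) (hn : e+1+s < n) :
    acFacet (e+1) n s = convexHull ℝ (YY e n s '' (range (e+1+s) : Set ℕ)) := by
  unfold acFacet
  congr 1
  ext x
  constructor
  · rintro ⟨j, hj, rfl⟩
    exact ⟨j, by simpa using hj, rfl⟩
  · rintro ⟨j, hj, rfl⟩
    have hj : j < e+1+s := by simpa using hj
    exact ⟨⟨j, by omega⟩, hj, rfl⟩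

lemma dim_P {e n s : ℕ} (he : 1 ≤ e) (hn : e+1+s < n) : polyDim (acPolytope (e+1) n s) ≠ e := by
  intro h
  rw [P_eq, polyDim_conv] at h
  have hlt : vectorSpan ℝ (YY e n s '' (range n : Set ℕ)) < ⊤ := by
    rw [lt_top_iff_ne_top]
    intro ht
    rw [ht] at h
    simp at h
  obtain ⟨f, hf, hle⟩ := Submodule.exists_le_ker_of_lt_top _ hlt
  set b : Fin (e+1) → ℝ := fun i => f (Pi.single i 1) with hb
  have hfb : ∀ x, dotp b x = f x := by
    intro x
    rw [← dl_apply]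
    congr 1
    apply LinearMap.pi_ext'
    intro i
    ext
    simp [dl_apply, dotp, hb, Pi.single_apply]
  have hb0 : b ≠ 0 := by
    intro h0
    apply hf
    ext x
    have := hfb (Pi.single x 1)
    rw [h0] at this
    simp [dotp] at this
    simpa using this.symm
  have := (T_card he hn (s := s) (c := f (YY e n s 0)) hb0 (T := range n) subset_rfl ?_ (by simp; omega) ?_).2
  · simp at this; omega
  · intro i hi
    rw [hfb]
    have : YY e n s i -ᵥ YY e n s 0 ∈ vectorSpan ℝ (YY e n s '' (range n : Set ℕ)) :=
      vsub_mem_vectorSpan ℝ ⟨i, by simpa using hi, rfl⟩ ⟨0, by simp; omega, rfl⟩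
    have := hle this
    rw [LinearMap.mem_ker, vsub_eq_sub, map_sub] at this
    linarith
  · intro h
    have := h (mem_range.2 hn)
    simp at this

lemma TS_func {e n s : ℕ} (he : 1 ≤ e) (hn : e+1+s < n) (hpar : (e+1) % 2 = 0) {S : Finset ℕ}
    (hS : S ∈ TS n (e+1+s) (e+1)) :
    S ⊆ range n ∧ S.card = e+1 ∧ ¬ S ⊆ range (e+1+s) ∧
    ∃ (b : Fin (e+1) → ℝ) (c : ℝ), b ≠ 0 ∧ (∀ j < n, dotp b (YY e n s j) ≤ c) ∧
      (∀ j < n, (dotp b (YY e n s j) = c ↔ j ∈ S)) := by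
  rw [TS, mem_filter, mem_union, mem_GS, mem_GS] at hS
  obtain ⟨hS, hm⟩ := hS
  have hsub : S ⊆ range n := by rcases hS with h | h <;> exact h.1.1
  have hc : S.card = e+1 := by rcases hS with h | h <;> exact h.1.2
  refine ⟨hsub, hc, hm, ?_⟩
  have main : ∀ β : ℝ, β ≠ 0 → (∀ j < n, j ∉ S → β * ∏ i ∈ S, ((j:ℝ) - i) < 0) →
     ∃ (b : Fin (e+1) → ℝ) (c : ℝ), b ≠ 0 ∧ (∀ j < n, dotp b (YY e n s j) ≤ c) ∧
      (∀ j < n, (dotp b (YY e n s j) = c ↔ j ∈ S)) := by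
    intro β hβ hneg
    obtain ⟨b, c, hbl, hv⟩ := exists_func (n := n) (s := s) β hc
    have hlt : ∀ j < n, j ∉ S → dotp b (YY e n s j) < c := by
      intro j hj hjS
      have h1 := main_eq hc hv hjS
      have h2 := DD_pos he hn hsub hc hm hj hjS
      have h3 := hneg j hj hjS
      rw [hbl] at h1
      have := mul_neg_of_neg_of_pos h3 h2
      linarith
    refine ⟨b, c, ?_, ?_, ?_⟩
    · rintro rfl; exact hβ (by simpa using hbl.symm)
    · intro j hj
      by_cases hjS : j ∈ S
      · exact (hv j hjS).le
      · exact (hlt j hj hjS).le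
    · intro j hj
      refine ⟨fun h => ?_, hv j⟩
      by_contra hjS
      exact (hlt j hj hjS).ne h
  rcases hS with h | h
  · apply main (-1) (by norm_num)
    intro j hj hjS
    have := (prod_par (by rw [hc, hpar]) hjS).1 (h.2 j hj hjS)
    linarith
  · apply main 1 (by norm_num)
    intro j hj hjS
    have := (prod_par (by rw [hc, hpar]) hjS).2 (h.2 j hj hjS)
    linarith

lemma YY_last (e n s j : ℕ) : YY e n s j (Fin.last e) = PP e n s j := by
  simp [YY, acy, PP]

lemma facets_eq {e n s : ℕ} (he : 1 ≤ e) (hn : e+1+s < n) (hpar : (e+1) % 2 = 0) :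
    {G : Set (Fin (e+1) → ℝ) | IsFacetOf (acPolytope (e+1) n s) G ∧ G ≠ acFacet (e+1) n s} =
      (fun S : Finset ℕ => convexHull ℝ (YY e n s '' (S : Set ℕ))) ''
        (TS n (e+1+s) (e+1) : Set (Finset ℕ)) := by
  ext G
  constructor
  · rintro ⟨⟨hface, hne, hdim⟩, hGF⟩
    rcases hface with rfl | rfl | ⟨b, c, hb, hle, hG⟩
    · simp at hne
    · exact absurd hdim (dim_P he hn)
    · have hle' : ∀ i ∈ range n, dotp b (YY e n s i) ≤ c := by
        intro i hi
        apply hle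
        rw [P_eq]
        exact subset_convexHull _ _ ⟨i, hi, rfl⟩
      rw [P_eq, face_eq _ _ _ _ hle'] at hG
      set T := (range n).filter (fun i => dotp b (YY e n s i) = c) with hT
      have hTne : T.Nonempty := by
        rw [nonempty_iff_ne_empty]
        intro h0
        rw [hG, h0] at hne
        simp at hne
      have hTc : e+1 ≤ T.card := by
        have := dim_le (YY e n s) T hTne
        rw [← hG, hdim] at this
        omega
      have hTv : ∀ i ∈ T, dotp b (YY e n s i) = c := fun i hi => (mem_filter.1 hi).2
      have hTs : T ⊆ range n := filter_subset _ _
      by_cases hm : T ⊆ range (e+1+s)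
      · exfalso
        have hR := RR_eq_zero hTc hTv (fun i hi => by
          rw [PP_zero (mem_range.1 (hm hi)), mul_zero])
        apply hGF
        rw [hG, F_eq _ _ _ hn]
        have : T = range (e+1+s) := by
          apply subset_antisymm hm
          intro i hi
          rw [hT, mem_filter]
          refine ⟨mem_range.2 (by have := mem_range.1 hi; omega), ?_⟩
          have := gg_eq (n := n) (s := s) (j := i) b c
          rw [hR, PP_zero (mem_range.1 hi)] at this
          simp at this
          linarith
        rw [this]
      · obtain ⟨hbl, hcard⟩ := T_card he hn hb hTs hTv hTc hm
        refine ⟨T, ?_, hG.symm⟩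
        rw [mem_coe, TS, mem_filter, mem_union, mem_GS, mem_GS]
        refine ⟨?_, hm⟩
        have hkey : ∀ j < n, j ∉ T → b (Fin.last e) * ∏ i ∈ T, ((j:ℝ) - i) ≤ 0 := by
          intro j hj hjT
          have h1 := main_eq hcard hTv hjT
          have h2 := DD_pos he hn hTs hcard hm hj hjT
          have h3 := hle' j (mem_range.2 hj)
          by_contra hcon
          have := mul_pos (not_le.1 hcon) h2
          linarith
        rcases lt_or_gt_of_ne hbl with hneg | hpos
        · left
          refine ⟨⟨hTs, hcard⟩, fun j hj hjT => ?_⟩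
          by_contra hcon
          have h1 := (prod_par (by rw [hcard, hpar]) hjT).2 (by omega)
          have h2 := hkey j hj hjT
          nlinarith
        · right
          refine ⟨⟨hTs, hcard⟩, fun j hj hjT => ?_⟩
          by_contra hcon
          have h1 := (prod_par (by rw [hcard, hpar]) hjT).1 (by omega)
          have h2 := hkey j hj hjT
          nlinarith
  · rintro ⟨S, hS, rfl⟩
    obtain ⟨hsub, hc, hm, b, c, hb, hle, hiff⟩ := TS_func he hn hpar hS
    refine ⟨⟨Or.inr (Or.inr ⟨b, c, hb, ?_, ?_⟩), ?_, ?_⟩, ?_⟩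
    · rw [P_eq]
      intro x hx
      have : convexHull ℝ (YY e n s '' (range n : Set ℕ)) ⊆ {x | dotp b x ≤ c} := by
        apply convexHull_min
        · rintro _ ⟨i, hi, rfl⟩
          exact hle i (by simpa using hi)
        · exact convex_halfSpace_le (dl b).isLinear c
      exact this hx
    · rw [P_eq, face_eq _ _ _ _ (fun i hi => hle i (mem_range.1 hi))]
      congr 3
      ext i
      rw [mem_filter]
      constructor
      · intro hi
        exact ⟨hsub hi, (hiff i (mem_range.1 (hsub hi))).2 hi⟩
      · rintro ⟨h1, h2⟩
        exact (hiff i (mem_range.1 h1)).1 h2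
    · simp only [convexHull_nonempty_iff, Set.image_nonempty, coe_nonempty]
      rw [← card_pos]; omega
    · exact dim_eq S hc
    · intro hF
      simp only [F_eq _ _ _ hn] at hF
      obtain ⟨x, hx, hx'⟩ := not_subset.1 hm
      have h1 : YY e n s x ∈ convexHull ℝ (YY e n s '' (S : Set ℕ)) :=
        subset_convexHull _ _ ⟨x, hx, rfl⟩
      rw [hF] at h1
      have hd : ∀ z : Fin (e+1) → ℝ, dotp (Pi.single (Fin.last e) 1) z = z (Fin.last e) := by
        intro z; simp [dotp, Pi.single_apply]
      have h2 := conv_eq _ _ (Pi.single (Fin.last e) 1) 0 (fun i hi => by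
        rw [hd, YY_last, PP_zero (mem_range.1 hi)]) h1
      rw [hd, YY_last] at h2
      have := PP_pos (j := x) hn (by simpa using hx')
      linarith

lemma facets_inj {e n s : ℕ} (he : 1 ≤ e) (hn : e+1+s < n) (hpar : (e+1) % 2 = 0) :
    Set.InjOn (fun S : Finset ℕ => convexHull ℝ (YY e n s '' (S : Set ℕ)))
        (TS n (e+1+s) (e+1) : Set (Finset ℕ)) := by
  intro S hS S' hS' h
  simp only [] at h
  obtain ⟨hsub, hc, hm, b, c, hb, hle, hiff⟩ := TS_func he hn hpar hS
  obtain ⟨hsub', hc', _⟩ := TS_func he hn hpar hS'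
  symm
  apply eq_of_subset_of_card_le _ (by omega)
  intro i hi
  have hin := mem_range.1 (hsub' hi)
  rw [← hiff i hin]
  have : YY e n s i ∈ convexHull ℝ (YY e n s '' (S' : Set ℕ)) :=
    subset_convexHull _ _ ⟨i, hi, rfl⟩
  rw [← h] at this
  exact conv_eq _ _ b c (fun k hk => (hiff k (mem_range.1 (hsub hk))).2 hk) this

/-- **Facet count of the almost cyclic polytope for even `d`.** For even `d ≥ 2`, `s ≥ 0`,
`n > d+s`, the number of simplex facets of `C(d,n,s)` (the facets of `C' = ∂C(d,n,s) − {F}`)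
equals `C(n−d/2−1, d/2) + 2·Σ_{i=0}^{d/2−1} C(n−d−1+i, i) − C(s+d/2, d/2)`. -/
theorem acPolytope_facet_count (d n s : ℕ) (hd : 2 ≤ d) (hdeven : Even d)
    (hn : d + s < n) :
    ({G : Set (Fin d → ℝ) | IsFacetOf (acPolytope d n s) G ∧ G ≠ acFacet d n s}.ncard : ℤ)
      = ((n - d / 2 - 1).choose (d / 2) : ℤ)
        + 2 * ∑ i ∈ Finset.range (d / 2), ((n - d - 1 + i).choose i : ℤ)
        - ((s + d / 2).choose (d / 2) : ℤ) := by
  obtain ⟨e, rfl⟩ : ∃ e, d = e+1 := ⟨d-1, by omega⟩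
  have hpar := Nat.even_iff.1 hdeven
  rw [facets_eq (by omega) hn hpar, (facets_inj (by omega) hn hpar).ncard_image,
    Set.ncard_coe_finset]
  obtain ⟨k, hk⟩ : ∃ k, e+1 = 2*k := ⟨(e+1)/2, by omega⟩
  rw [hk] at hn ⊢
  rw [count_final k n s (by omega) hn, show 2*k/2 = k by omega]

end

end ASP
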